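/- Let 1 < p < 3, A > 0, and let H : [0, T] → [0, ∞) be differentiable with H′(t) ≤ A (2 + H(t)) (ln(2 + H(t)))^{(p−1)/2} for all t ∈ [0, T]. Then for all t ∈ [0, T]: 2 + H(t) ≤ exp( ( ((3−p)/2) A t + (ln(2 + H(0)))^{(3−p)/2} )^{2/(3−p)} ). In particular H stays bounded on bounded time intervals. -/

import Mathlib

open Real

/-- **Lemma (logarithmic Gronwall inequality).** If `H : [0,T] → [0,∞)` is differentiable and
`H' ≤ A (2+H) (ln(2+H))^{(p-1)/2}` on `[0,T]` with `1 < p < 3`, then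
`2 + H(t) ≤ exp((((3-p)/2) A t + (ln(2+H(0)))^{(3-p)/2})^{2/(3-p)})` on `[0,T]`. -/
theorem log_gronwall (p A T : ℝ) (hp1 : 1 < p) (hp3 : p < 3) (hA : 0 < A) (hT : 0 ≤ T)
    (H H' : ℝ → ℝ) (hpos : ∀ t ∈ Set.Icc (0 : ℝ) T, 0 ≤ H t)
    (hderiv : ∀ t ∈ Set.Icc (0 : ℝ) T, HasDerivWithinAt H (H' t) (Set.Icc (0 : ℝ) T) t)
    (hbound : ∀ t ∈ Set.Icc (0 : ℝ) T,
      H' t ≤ A * (2 + H t) * Real.log (2 + H t) ^ ((p - 1) / 2)) :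
    ∀ t ∈ Set.Icc (0 : ℝ) T,
      2 + H t ≤
        Real.exp ((((3 - p) / 2) * A * t + Real.log (2 + H 0) ^ ((3 - p) / 2)) ^ (2 / (3 - p))) := by
  have hq : 0 < (3 - p) / 2 := by linarith
  have hlog : ∀ t ∈ Set.Icc (0 : ℝ) T, 0 < Real.log (2 + H t) := fun t ht =>
    Real.log_pos (by linarith [hpos t ht])
  have hF : ∀ t ∈ Set.Icc (0 : ℝ) T,
      HasDerivWithinAt (fun s => Real.log (2 + H s) ^ ((3 - p) / 2))
        (H' t / (2 + H t) * ((3 - p) / 2) * Real.log (2 + H t) ^ ((3 - p) / 2 - 1))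
        (Set.Icc (0 : ℝ) T) t := fun t ht =>
    (((hderiv t ht).const_add 2).log (by linarith [hpos t ht])).rpow_const
      (Or.inl (hlog t ht).ne')
  have hF_le : ∀ t ∈ Set.Icc (0 : ℝ) T,
      H' t / (2 + H t) * ((3 - p) / 2) * Real.log (2 + H t) ^ ((3 - p) / 2 - 1)
        ≤ (3 - p) / 2 * A := by
    intro t ht
    have h2 : 0 < 2 + H t := by linarith [hpos t ht]
    have hl := hlog t ht
    have hdiv : H' t / (2 + H t) ≤ A * Real.log (2 + H t) ^ ((p - 1) / 2) := by
      rw [div_le_iff₀ h2]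
      linarith [hbound t ht]
    have hcancel :
        Real.log (2 + H t) ^ ((p - 1) / 2) * Real.log (2 + H t) ^ ((3 - p) / 2 - 1) = 1 := by
      rw [← Real.rpow_add hl, show (p - 1) / 2 + ((3 - p) / 2 - 1) = 0 by ring, Real.rpow_zero]
    calc H' t / (2 + H t) * ((3 - p) / 2) * Real.log (2 + H t) ^ ((3 - p) / 2 - 1)
        ≤ A * Real.log (2 + H t) ^ ((p - 1) / 2) * ((3 - p) / 2)
            * Real.log (2 + H t) ^ ((3 - p) / 2 - 1) := by gcongr
      _ = (3 - p) / 2 * A := by linear_combination (3 - p) / 2 * A * hcancel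
  have hB : ∀ t, HasDerivAt
      (fun s => (3 - p) / 2 * A * s + Real.log (2 + H 0) ^ ((3 - p) / 2)) ((3 - p) / 2 * A) t :=
    fun t => (hasDerivAt_const_mul ((3 - p) / 2 * A)).add_const _
  intro t ht
  have hmain : Real.log (2 + H t) ^ ((3 - p) / 2)
      ≤ (3 - p) / 2 * A * t + Real.log (2 + H 0) ^ ((3 - p) / 2) :=
    image_le_of_deriv_right_le_deriv_boundary (fun s hs => (hF s hs).continuousWithinAt)
      (fun s hs => (hF s (Set.Ico_subset_Icc_self hs)).mono_of_mem_nhdsWithin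
        (Icc_mem_nhdsGE_of_mem hs))
      (by simp) (fun s _ => (hB s).continuousAt.continuousWithinAt)
      (fun s _ => (hB s).hasDerivWithinAt)
      (fun s hs => hF_le s (Set.Ico_subset_Icc_self hs)) ht
  have h2 : 0 < 2 + H t := by linarith [hpos t ht]
  rw [← Real.log_le_iff_le_exp h2, ← inv_div (3 - p) 2]
  exact (Real.le_rpow_inv_iff_of_pos (hlog t ht).le
    ((Real.rpow_nonneg (hlog t ht).le _).trans hmain) hq).2 hmain
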